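/- In the backward framework, there exists T ∈ (0, T̄] such that the nonnegative spacetime integral ∫∫_{D(0,T)} [(u − sin u·cos u)²/r⁵ + u·sin(2u)/r³ + u·(u − sin u·cos u)·(1 − cos 2u)/r⁵] r² dr dt is finite, where D(0,T) = {(t,r) : 0 < r ≤ min(2T − t, t)} and all quantities are evaluated at (t,r). -/

import Mathlib

open Real MeasureTheory Set Filter Topology

/-- Time derivative `u_t`. -/
noncomputable def ut (u : ℝ → ℝ → ℝ) (t r : ℝ) : ℝ := deriv (fun s => u s r) t

/-- Radial derivative `u_r`. -/
noncomputable def ur (u : ℝ → ℝ → ℝ) (t r : ℝ) : ℝ := deriv (fun s => u t s) r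

/-- Second time derivative `u_tt`. -/
noncomputable def utt (u : ℝ → ℝ → ℝ) (t r : ℝ) : ℝ := deriv (fun s => ut u s r) t

/-- Second radial derivative `u_rr`. -/
noncomputable def urr (u : ℝ → ℝ → ℝ) (t r : ℝ) : ℝ := deriv (fun s => ur u t s) r

/-- Null derivative `u₊ = u_t + u_r`. -/
noncomputable def uplus (u : ℝ → ℝ → ℝ) (t r : ℝ) : ℝ := ut u t r + ur u t r

/-- Null derivative `u₋ = u_t - u_r`. -/
noncomputable def uminus (u : ℝ → ℝ → ℝ) (t r : ℝ) : ℝ := ut u t r - ur u t r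

/-- The Adkins–Nappi equivariant wave equation at the point `(t, r)`. -/
def ANeq (u : ℝ → ℝ → ℝ) (t r : ℝ) : Prop :=
  utt u t r - urr u t r - (2 / r) * ur u t r + Real.sin (2 * u t r) / r ^ 2 +
      (u t r - Real.sin (u t r) * Real.cos (u t r)) * (1 - Real.cos (2 * u t r)) / r ^ 4 = 0

/-- The energy density `e(t,r)`. -/
noncomputable def eDens (u : ℝ → ℝ → ℝ) (t r : ℝ) : ℝ :=
  (1 / 2) * (ut u t r ^ 2 + ur u t r ^ 2) + Real.sin (u t r) ^ 2 / r ^ 2 +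
    (u t r - Real.sin (u t r) * Real.cos (u t r)) ^ 2 / (2 * r ^ 4)

/-- The backward domain `D(T̄)`. -/
def Dom (T : ℝ) : Set (ℝ × ℝ) :=
  {p : ℝ × ℝ | 0 < p.1 ∧ p.1 ≤ 2 * T ∧ 0 ≤ p.2 ∧ p.2 ≤ min (2 * T - p.1) p.1}

/-- The local energy `E(t) = ∫_0^t e(t,r) r² dr`. -/
noncomputable def locE (u : ℝ → ℝ → ℝ) (t : ℝ) : ℝ := ∫ r in (0 : ℝ)..t, eDens u t r * r ^ 2

/-- The flux `F(t₀, t₁)` through the light cone `t = r`. -/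
noncomputable def flux (u : ℝ → ℝ → ℝ) (t₀ t₁ : ℝ) : ℝ :=
  ∫ r in t₀..t₁,
    ((1 / 2) * uplus u r r ^ 2 + Real.sin (u r r) ^ 2 / r ^ 2 +
      (u r r - Real.sin (u r r) * Real.cos (u r r)) ^ 2 / (2 * r ^ 4)) * r ^ 2

/-- The backward framework: `u` is smooth on a neighborhood of `D(T̄)`, solves the
Adkins–Nappi equation on `D(T̄)` (for `r > 0`), and has finite energy `E(T̄)`. -/
def BackwardFramework (u : ℝ → ℝ → ℝ) (T : ℝ) : Prop :=
  0 < T ∧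
  (∃ V : Set (ℝ × ℝ), IsOpen V ∧ Dom T ⊆ V ∧
    ContDiffOn ℝ (⊤ : ℕ∞) (fun p : ℝ × ℝ => u p.1 p.2) V) ∧
  (∀ p ∈ Dom T, 0 < p.2 → ANeq u p.1 p.2) ∧
  IntegrableOn (fun r => eDens u T r * r ^ 2) (Set.Ioc 0 T)

/-- The solid backward cone `D(0,T) = {(t,r) : 0 < r ≤ min (2T - t) t}`. -/
def Dcone (T : ℝ) : Set (ℝ × ℝ) :=
  {p : ℝ × ℝ | 0 < p.2 ∧ p.2 ≤ min (2 * T - p.1) p.1}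

/-- `u` is smooth, as a function of two variables, on `V`. -/
def SmoothOn (u : ℝ → ℝ → ℝ) (V : Set (ℝ × ℝ)) : Prop :=
  ContDiffOn ℝ (⊤ : ℕ∞) (fun p : ℝ × ℝ => u p.1 p.2) V

section Smooth

variable {u : ℝ → ℝ → ℝ} {V : Set (ℝ × ℝ)} {t r : ℝ}

lemma SmoothOn.contDiffAt (hu : SmoothOn u V) (hV : IsOpen V) (hp : (t, r) ∈ V) :
    ContDiffAt ℝ (⊤ : ℕ∞) (fun p : ℝ × ℝ => u p.1 p.2) (t, r) :=
  ContDiffOn.contDiffAt hu (hV.mem_nhds hp)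

lemma SmoothOn.hasFDerivAt_fderiv (hu : SmoothOn u V) (hV : IsOpen V) (hp : (t, r) ∈ V) :
    HasFDerivAt (fun p : ℝ × ℝ => u p.1 p.2)
      (fderiv ℝ (fun p : ℝ × ℝ => u p.1 p.2) (t, r)) (t, r) :=
  ((hu.contDiffAt hV hp).differentiableAt (by simp)).hasFDerivAt

lemma SmoothOn.ut_eq (hu : SmoothOn u V) (hV : IsOpen V) (hp : (t, r) ∈ V) :
    ut u t r = fderiv ℝ (fun p : ℝ × ℝ => u p.1 p.2) (t, r) (1, 0) := by
  have h := HasFDerivAt.comp_hasDerivAt t (f := fun s : ℝ => (s, r))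
    (hu.hasFDerivAt_fderiv hV hp) ((hasDerivAt_id t).prodMk (hasDerivAt_const t r))
  exact h.deriv

lemma SmoothOn.ur_eq (hu : SmoothOn u V) (hV : IsOpen V) (hp : (t, r) ∈ V) :
    ur u t r = fderiv ℝ (fun p : ℝ × ℝ => u p.1 p.2) (t, r) (0, 1) := by
  have h := HasFDerivAt.comp_hasDerivAt r (f := fun s : ℝ => (t, s))
    (hu.hasFDerivAt_fderiv hV hp) ((hasDerivAt_const r t).prodMk (hasDerivAt_id r))
  exact h.deriv

lemma SmoothOn.ut (hu : SmoothOn u V) (hV : IsOpen V) : SmoothOn (ut u) V := by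
  have h : ContDiffOn ℝ (⊤ : ℕ∞)
      (fun p => fderiv ℝ (fun p : ℝ × ℝ => u p.1 p.2) p (1, 0)) V :=
    (ContDiffOn.fderiv_of_isOpen (m := (⊤ : ℕ∞)) hu hV (by simp)).clm_apply contDiffOn_const
  exact h.congr fun p hp => hu.ut_eq hV hp

lemma SmoothOn.ur (hu : SmoothOn u V) (hV : IsOpen V) : SmoothOn (ur u) V := by
  have h : ContDiffOn ℝ (⊤ : ℕ∞)
      (fun p => fderiv ℝ (fun p : ℝ × ℝ => u p.1 p.2) p (0, 1)) V :=
    (ContDiffOn.fderiv_of_isOpen (m := (⊤ : ℕ∞)) hu hV (by simp)).clm_apply contDiffOn_const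
  exact h.congr fun p hp => hu.ur_eq hV hp

lemma SmoothOn.hasFDerivAt (hu : SmoothOn u V) (hV : IsOpen V) (hp : (t, r) ∈ V) :
    HasFDerivAt (fun p : ℝ × ℝ => u p.1 p.2)
      (_root_.ut u t r • ContinuousLinearMap.fst ℝ ℝ ℝ +
        _root_.ur u t r • ContinuousLinearMap.snd ℝ ℝ ℝ) (t, r) := by
  convert! hu.hasFDerivAt_fderiv hV hp using 1
  ext <;> simp [hu.ut_eq hV hp, hu.ur_eq hV hp]

lemma SmoothOn.ur_ut (hu : SmoothOn u V) (hV : IsOpen V) (hp : (t, r) ∈ V) :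
    _root_.ur (_root_.ut u) t r = _root_.ut (_root_.ur u) t r := by
  set w := fun p : ℝ × ℝ => u p.1 p.2
  have hd : DifferentiableAt ℝ (fderiv ℝ w) (t, r) :=
    ((hu.contDiffAt hV hp).fderiv_right (m := 1)
      (WithTop.coe_le_coe.2 (le_top : (2 : ℕ∞) ≤ ⊤))).differentiableAt (by simp)
  have key : ∀ x : ℝ × ℝ,
      fderiv ℝ (fun p => fderiv ℝ w p x) (t, r) = (fderiv ℝ (fderiv ℝ w) (t, r)).flip x := by
    intro x
    rw [fderiv_clm_apply hd (by simp)]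
    simp
  have h1 : (fun p : ℝ × ℝ => _root_.ut u p.1 p.2) =ᶠ[𝓝 (t, r)] fun p => fderiv ℝ w p (1, 0) :=
    eventually_of_mem (hV.mem_nhds hp) fun p hp => hu.ut_eq hV hp
  have h2 : (fun p : ℝ × ℝ => _root_.ur u p.1 p.2) =ᶠ[𝓝 (t, r)] fun p => fderiv ℝ w p (0, 1) :=
    eventually_of_mem (hV.mem_nhds hp) fun p hp => hu.ur_eq hV hp
  rw [(hu.ut hV).ur_eq hV hp, (hu.ur hV).ut_eq hV hp, h1.fderiv_eq, h2.fderiv_eq, key, key]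
  exact (hu.contDiffAt hV hp).isSymmSndFDerivAt
    (by simpa using WithTop.coe_le_coe.2 (le_top : (2 : ℕ∞) ≤ ⊤)) _ _

end Smooth

/-- The nonlinearity `u - sin u cos u`. -/
noncomputable def skyrme (a : ℝ) : ℝ := a - Real.sin a * Real.cos a

/-- The Morawetz density of `u`. -/
noncomputable def morawetz (u : ℝ → ℝ → ℝ) (t r : ℝ) : ℝ :=
  skyrme (u t r) ^ 2 / r ^ 3 + u t r * Real.sin (2 * u t r) / r +
    u t r * skyrme (u t r) * (1 - Real.cos (2 * u t r)) / r ^ 3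

/-- The coordinates `t = x (1 - y)`, `r = x y`, in which the cone `0 < r ≤ min (2T - t) t` is the
rectangle `0 < x ≤ 2T`, `0 < y ≤ 1/2`. -/
def coneMap (p : ℝ × ℝ) : ℝ × ℝ := (p.1 * (1 - p.2), p.1 * p.2)

/-- The null derivative `(r u)_t - (r u)_r` in the coordinates of `coneMap`. -/
noncomputable def nullDeriv (u : ℝ → ℝ → ℝ) (p : ℝ × ℝ) : ℝ :=
  p.1 * p.2 * (ut u (p.1 * (1 - p.2)) (p.1 * p.2) - ur u (p.1 * (1 - p.2)) (p.1 * p.2)) -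
    u (p.1 * (1 - p.2)) (p.1 * p.2)

/-- `r²` times the potential part of the energy density, in the coordinates of `coneMap`. -/
noncomputable def potential (u : ℝ → ℝ → ℝ) (p : ℝ × ℝ) : ℝ :=
  Real.sin (u (p.1 * (1 - p.2)) (p.1 * p.2)) ^ 2 +
    skyrme (u (p.1 * (1 - p.2)) (p.1 * p.2)) ^ 2 / (2 * (p.1 * p.2) ^ 2)

/-- First component of the Morawetz vector field in the coordinates of `coneMap`. -/
noncomputable def fieldFst (u : ℝ → ℝ → ℝ) (p : ℝ × ℝ) : ℝ := p.1 * nullDeriv u p ^ 2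

/-- Second component of the Morawetz vector field in the coordinates of `coneMap`. -/
noncomputable def fieldSnd (u : ℝ → ℝ → ℝ) (p : ℝ × ℝ) : ℝ :=
  (1 - 2 * p.2) / 2 * nullDeriv u p ^ 2 - potential u p

section Divergence

variable {u : ℝ → ℝ → ℝ} {V : Set (ℝ × ℝ)} {x y : ℝ}

lemma SmoothOn.hasDerivAt_fst (hu : SmoothOn u V) (hV : IsOpen V)
    (hp : (x * (1 - y), x * y) ∈ V) :
    HasDerivAt (fun x => u (x * (1 - y)) (x * y))
      ((1 - y) * _root_.ut u (x * (1 - y)) (x * y) + y * _root_.ur u (x * (1 - y)) (x * y)) x := by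
  have h := HasFDerivAt.comp_hasDerivAt x (f := fun x : ℝ => (x * (1 - y), x * y))
    (hu.hasFDerivAt hV hp)
    (((hasDerivAt_id x).mul_const (1 - y)).prodMk ((hasDerivAt_id x).mul_const y))
  convert! h using 1
  simp
  ring

lemma SmoothOn.hasDerivAt_snd (hu : SmoothOn u V) (hV : IsOpen V)
    (hp : (x * (1 - y), x * y) ∈ V) :
    HasDerivAt (fun y => u (x * (1 - y)) (x * y))
      (x * (_root_.ur u (x * (1 - y)) (x * y) - _root_.ut u (x * (1 - y)) (x * y))) y := by
  have h := HasFDerivAt.comp_hasDerivAt y (f := fun y : ℝ => (x * (1 - y), x * y))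
    (hu.hasFDerivAt hV hp)
    ((((hasDerivAt_id y).const_sub 1).const_mul x).prodMk ((hasDerivAt_id y).const_mul x))
  convert! h using 1
  simp
  ring

lemma SmoothOn.differentiableAt_coneMap (hu : SmoothOn u V) (hV : IsOpen V)
    (hp : (x * (1 - y), x * y) ∈ V) :
    DifferentiableAt ℝ (fun p : ℝ × ℝ => u (p.1 * (1 - p.2)) (p.1 * p.2)) (x, y) :=
  DifferentiableAt.comp (x, y) (f := coneMap) (g := fun p : ℝ × ℝ => u p.1 p.2)
    (hu.hasFDerivAt hV hp).differentiableAt (by unfold coneMap; fun_prop)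

lemma SmoothOn.differentiableAt_nullDeriv (hu : SmoothOn u V) (hV : IsOpen V)
    (hp : (x * (1 - y), x * y) ∈ V) : DifferentiableAt ℝ (nullDeriv u) (x, y) := by
  have h0 := hu.differentiableAt_coneMap hV hp
  have h1 := (hu.ut hV).differentiableAt_coneMap hV hp
  have h2 := (hu.ur hV).differentiableAt_coneMap hV hp
  exact ((differentiableAt_fst.mul differentiableAt_snd).mul (h1.sub h2)).sub h0

lemma SmoothOn.differentiableAt_fieldFst (hu : SmoothOn u V) (hV : IsOpen V)
    (hp : (x * (1 - y), x * y) ∈ V) : DifferentiableAt ℝ (fieldFst u) (x, y) := by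
  have h0 := hu.differentiableAt_nullDeriv hV hp
  unfold fieldFst
  fun_prop

lemma SmoothOn.differentiableAt_potential (hu : SmoothOn u V) (hV : IsOpen V)
    (hp : (x * (1 - y), x * y) ∈ V) (hx : x ≠ 0) (hy : y ≠ 0) :
    DifferentiableAt ℝ (potential u) (x, y) := by
  have h0 := hu.differentiableAt_coneMap hV hp
  have h1 : (fun p : ℝ × ℝ => 2 * (p.1 * p.2) ^ 2) (x, y) ≠ 0 := by positivity
  have h2 : DifferentiableAt ℝ (fun p : ℝ × ℝ => 2 * (p.1 * p.2) ^ 2) (x, y) := by fun_prop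
  have h3 := (h0.sin.pow 2).add (((h0.sub (h0.sin.mul h0.cos)).pow 2).mul (h2.inv h1))
  unfold potential skyrme
  simp only [div_eq_mul_inv]
  exact h3

lemma SmoothOn.differentiableAt_fieldSnd (hu : SmoothOn u V) (hV : IsOpen V)
    (hp : (x * (1 - y), x * y) ∈ V) (hx : x ≠ 0) (hy : y ≠ 0) :
    DifferentiableAt ℝ (fieldSnd u) (x, y) := by
  have h0 := hu.differentiableAt_nullDeriv hV hp
  have h1 := hu.differentiableAt_potential hV hp hx hy
  unfold fieldSnd
  fun_prop

lemma SmoothOn.divergence_eq (hu : SmoothOn u V) (hV : IsOpen V)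
    (hp : (x * (1 - y), x * y) ∈ V) (hx : x ≠ 0) (hy : y ≠ 0)
    (heq : ANeq u (x * (1 - y)) (x * y)) :
    fderiv ℝ (fieldFst u) (x, y) (1, 0) + fderiv ℝ (fieldSnd u) (x, y) (0, 1) =
      x * morawetz u (x * (1 - y)) (x * y) := by
  have hA := (hu.differentiableAt_fieldFst hV hp).hasFDerivAt.comp_hasDerivAt x
    (f := fun x : ℝ => (x, y)) ((hasDerivAt_id x).prodMk (hasDerivAt_const x y))
  have hB := (hu.differentiableAt_fieldSnd hV hp hx hy).hasFDerivAt.comp_hasDerivAt y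
    (f := fun y : ℝ => (x, y)) ((hasDerivAt_const y x).prodMk (hasDerivAt_id y))
  have x0 := hu.hasDerivAt_fst hV hp
  have x1 := (hu.ut hV).hasDerivAt_fst hV hp
  have x2 := (hu.ur hV).hasDerivAt_fst hV hp
  have y0 := hu.hasDerivAt_snd hV hp
  have y1 := (hu.ut hV).hasDerivAt_snd hV hp
  have y2 := (hu.ur hV).hasDerivAt_snd hV hp
  have hxn := (((hasDerivAt_id x).mul_const y).mul (x1.sub x2)).sub x0
  have hyn := (((hasDerivAt_id y).const_mul x).mul (y1.sub y2)).sub y0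
  have hA' := (hasDerivAt_id x).mul (hxn.pow 2)
  have hd : 2 * (x * y) ^ 2 ≠ 0 := by positivity
  have hpot := (y0.sin.pow 2).add (((y0.sub (y0.sin.mul y0.cos)).pow 2).div
    ((((hasDerivAt_id y).const_mul x).pow 2).const_mul 2) hd)
  have hB' := ((((hasDerivAt_id y).const_mul 2).const_sub 1).div_const 2 |>.mul (hyn.pow 2)).sub hpot
  have eA := hA.unique hA'
  have eB := hB.unique hB'
  rw [eA, eB]
  have hsym := hu.ur_ut hV hp
  have hutt : _root_.ut (_root_.ut u) (x * (1 - y)) (x * y) = utt u (x * (1 - y)) (x * y) := rfl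
  have hurr : _root_.ur (_root_.ur u) (x * (1 - y)) (x * y) = urr u (x * (1 - y)) (x * y) := rfl
  unfold ANeq at heq
  rw [hsym, hutt, hurr]
  unfold morawetz skyrme
  rw [Real.sin_two_mul, Real.cos_two_mul] at *
  simp only [id, Pi.sub_apply, Pi.mul_apply, Pi.pow_apply]
  have hsc := Real.sin_sq_add_cos_sq (u (x * (1 - y)) (x * y))
  generalize Real.sin (u (x * (1 - y)) (x * y)) = s at *
  generalize Real.cos (u (x * (1 - y)) (x * y)) = c at *
  generalize u (x * (1 - y)) (x * y) = w at *
  generalize utt u (x * (1 - y)) (x * y) = att at *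
  generalize urr u (x * (1 - y)) (x * y) = arr at *
  generalize _root_.ut u (x * (1 - y)) (x * y) = ap at *
  generalize _root_.ur u (x * (1 - y)) (x * y) = ar at *
  generalize _root_.ut (_root_.ur u) (x * (1 - y)) (x * y) = atr at *
  have hs : s ^ 2 = 1 - c ^ 2 := by linarith
  have hatt : att = arr + (2 / (x * y)) * ar - 2 * s * c / (x * y) ^ 2 -
      (w - s * c) * (1 - (2 * c ^ 2 - 1)) / (x * y) ^ 4 := by linear_combination heq
  rw [hatt]
  push_cast
  field_simp
  linear_combination (-(w - s * c) * x * y * (ar - ap)) * hsc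

end Divergence

lemma abs_sin_mul_cos_le (a : ℝ) : |Real.sin a * Real.cos a| ≤ |Real.sin a| := by
  rw [abs_mul]
  exact mul_le_of_le_one_right (abs_nonneg _) (Real.abs_cos_le_one a)

lemma eq_zero_of_skyrme_eq_zero {a : ℝ} (h : skyrme a = 0) : a = 0 := by
  by_contra ha
  have h1 := abs_sin_mul_cos_le a
  rw [← sub_eq_zero.1 h] at h1
  exact absurd h1 (not_le.2 (Real.abs_sin_lt_abs ha))

lemma hasDerivAt_skyrme (a : ℝ) : HasDerivAt skyrme (2 * Real.sin a ^ 2) a := by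
  have h := (hasDerivAt_id a).sub ((Real.hasDerivAt_sin a).mul (Real.hasDerivAt_cos a))
  convert! h using 1
  linear_combination Real.sin_sq_add_cos_sq a

lemma continuous_skyrme : Continuous skyrme := by
  unfold skyrme
  fun_prop

lemma abs_skyrme_le (a : ℝ) : |skyrme a| ≤ 2 * |a| ^ 3 := by
  have h := (convex_Icc (-|a|) |a|).norm_image_sub_le_of_norm_hasDerivWithin_le
    (f := skyrme) (f' := fun x => 2 * Real.sin x ^ 2) (C := 2 * a ^ 2) (x := 0) (y := a)
    (fun x _ => (hasDerivAt_skyrme x).hasDerivWithinAt) (fun x hx => ?_) (by simp)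
    ⟨neg_abs_le a, le_abs_self a⟩
  · have h0 : skyrme 0 = 0 := by simp [skyrme]
    rw [h0, sub_zero, sub_zero, Real.norm_eq_abs, Real.norm_eq_abs, ← sq_abs a] at h
    linarith [h, pow_succ |a| 2]
  · rw [Real.norm_eq_abs, abs_of_nonneg (by positivity)]
    have h1 := Real.sin_sq_le_sq (x := x)
    have h2 : x ^ 2 ≤ a ^ 2 := sq_le_sq.2 (abs_le.2 hx)
    linarith

lemma morawetz_nonneg {u : ℝ → ℝ → ℝ} {t r : ℝ} (h0 : 0 < r) (h1 : r ≤ 1) :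
    0 ≤ morawetz u t r := by
  have h : morawetz u t r = ((1 - r ^ 2) * skyrme (u t r) ^ 2 +
      r ^ 2 * (u t r ^ 2 + (Real.sin (u t r) * Real.cos (u t r)) ^ 2) +
      2 * Real.sin (u t r) ^ 2 * (u t r * skyrme (u t r))) / r ^ 3 := by
    have hs := Real.sin_sq_add_cos_sq (u t r)
    have hs' : 1 - Real.cos (2 * u t r) = 2 * Real.sin (u t r) ^ 2 := by
      rw [Real.cos_two_mul]
      linarith
    unfold morawetz
    rw [hs', Real.sin_two_mul]
    unfold skyrme
    field_simp
    ring
  have hr : 0 ≤ 1 - r ^ 2 := by nlinarith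
  have hu : 0 ≤ u t r * skyrme (u t r) := by
    have hle := (abs_sin_mul_cos_le (u t r)).trans Real.abs_sin_le_abs
    have := abs_mul (u t r) (Real.sin (u t r) * Real.cos (u t r))
    have := le_abs_self (u t r * (Real.sin (u t r) * Real.cos (u t r)))
    have := mul_le_mul_of_nonneg_left hle (abs_nonneg (u t r))
    unfold skyrme
    nlinarith [abs_mul_abs_self (u t r)]
  rw [h]
  positivity

lemma SmoothOn.continuousAt_snd {u : ℝ → ℝ → ℝ} {V : Set (ℝ × ℝ)} {t r : ℝ}
    (hu : SmoothOn u V) (hV : IsOpen V) (hp : (t, r) ∈ V) :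
    ContinuousAt (fun s => u t s) r :=
  ContinuousAt.comp (f := fun s : ℝ => (t, s)) (g := fun p : ℝ × ℝ => u p.1 p.2)
    (hu.contDiffAt hV hp).continuousAt (by fun_prop)

lemma SmoothOn.continuousAt_fst {u : ℝ → ℝ → ℝ} {V : Set (ℝ × ℝ)} {t r : ℝ}
    (hu : SmoothOn u V) (hV : IsOpen V) (hp : (t, r) ∈ V) :
    ContinuousAt (fun s => u s r) t :=
  ContinuousAt.comp (f := fun s : ℝ => (s, r)) (g := fun p : ℝ × ℝ => u p.1 p.2)
    (hu.contDiffAt hV hp).continuousAt (by fun_prop)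

/-- On the axis the equation forces `u` to be a multiple of `π`. -/
lemma sin_eq_zero_on_axis {u : ℝ → ℝ → ℝ} {V : Set (ℝ × ℝ)} {t : ℝ}
    (hu : SmoothOn u V) (hV : IsOpen V) (hp : (t, 0) ∈ V)
    (heq : ∀ᶠ r in 𝓝[>] (0 : ℝ), ANeq u t r) : Real.sin (u t 0) = 0 := by
  have c0 := hu.continuousAt_snd hV hp
  have c1 := (hu.ur hV).continuousAt_snd hV hp
  have c2 := ((hu.ut hV).ut hV).continuousAt_snd hV hp
  have c3 := ((hu.ur hV).ur hV).continuousAt_snd hV hp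
  have cs := continuous_skyrme.continuousAt.comp c0
  set g : ℝ → ℝ := fun r => r ^ 4 * (ut (ut u) t r - ur (ur u) t r) - 2 * r ^ 3 * ur u t r +
    r ^ 2 * Real.sin (2 * u t r) + skyrme (u t r) * (1 - Real.cos (2 * u t r)) with hg
  have hc : ContinuousAt g 0 :=
    (((((continuousAt_id.pow 4).mul (c2.sub c3))).sub
      ((continuousAt_const.mul (continuousAt_id.pow 3)).mul c1)).add
      ((continuousAt_id.pow 2).mul (Real.continuous_sin.continuousAt.comp
        (continuousAt_const.mul c0)))).add
      (cs.mul (continuousAt_const.sub (Real.continuous_cos.continuousAt.comp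
        (continuousAt_const.mul c0))))
  have hz : ∀ᶠ r in 𝓝[>] (0 : ℝ), g r = 0 := by
    filter_upwards [heq, self_mem_nhdsWithin] with r hr hr0
    have hr0 : r ≠ 0 := ne_of_gt hr0
    have hr : ut (ut u) t r - ur (ur u) t r - (2 / r) * ur u t r + Real.sin (2 * u t r) / r ^ 2 +
      skyrme (u t r) * (1 - Real.cos (2 * u t r)) / r ^ 4 = 0 := hr
    have : g r = r ^ 4 * (ut (ut u) t r - ur (ur u) t r - (2 / r) * ur u t r +
        Real.sin (2 * u t r) / r ^ 2 +
        skyrme (u t r) * (1 - Real.cos (2 * u t r)) / r ^ 4) := by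
      simp only [hg]
      field_simp
    rw [this, hr, mul_zero]
  have h0 : g 0 = 0 := tendsto_nhds_unique (hc.tendsto.mono_left nhdsWithin_le_nhds)
    (tendsto_const_nhds.congr' (hz.mono fun r hr => hr.symm))
  have h1 : skyrme (u t 0) * (1 - Real.cos (2 * u t 0)) = 0 := by simpa [hg] using h0
  rcases mul_eq_zero.1 h1 with h | h
  · rw [eq_zero_of_skyrme_eq_zero h, Real.sin_zero]
  · rw [Real.cos_two_mul] at h
    have := Real.sin_sq_add_cos_sq (u t 0)
    exact pow_eq_zero_iff (two_ne_zero) |>.1 (by linarith)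

lemma eDens_mul_sq_ge {u : ℝ → ℝ → ℝ} {t r : ℝ} (hr : 0 < r) :
    skyrme (u t r) ^ 2 / (2 * r ^ 2) ≤ eDens u t r * r ^ 2 := by
  have h : eDens u t r * r ^ 2 = skyrme (u t r) ^ 2 / (2 * r ^ 2) +
      (1 / 2 * (ut u t r ^ 2 + ur u t r ^ 2) * r ^ 2 + Real.sin (u t r) ^ 2) := by
    unfold eDens skyrme
    field_simp
    ring
  rw [h]
  exact le_add_of_nonneg_right (by positivity)

/-- Finiteness of the energy at time `t` forces `u` to vanish on the axis at that time. -/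
lemma eq_zero_of_finite_energy {u : ℝ → ℝ → ℝ} {T : ℝ} (hT : 0 < T)
    (hc : ContinuousAt (fun r => u T r) 0)
    (hi : IntegrableOn (fun r => eDens u T r * r ^ 2) (Set.Ioc 0 T)) : u T 0 = 0 := by
  by_contra hne
  have hF : 0 < skyrme (u T 0) ^ 2 :=
    sq_pos_of_ne_zero fun h => hne (eq_zero_of_skyrme_eq_zero h)
  have hcF : ContinuousAt (fun r => skyrme (u T r) ^ 2) 0 :=
    (continuous_skyrme.continuousAt.comp hc).pow 2
  obtain ⟨d, hd, hball⟩ := Metric.eventually_nhds_iff.1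
    (hcF.eventually (lt_mem_nhds (half_lt_self hF)))
  set c := skyrme (u T 0) ^ 2 / 2
  have hc0 : 0 < c := half_pos hF
  set b := min (min (d / 2) T) 1
  have hb : 0 < b := by positivity
  have hbd : b < d := ((min_le_left _ _).trans (min_le_left _ _)).trans_lt (half_lt_self hd)
  have hbT : b ≤ T := (min_le_left _ _).trans (min_le_right _ _)
  have hb1 : b ≤ 1 := min_le_right _ _
  have hint : IntegrableOn (fun r : ℝ => c / 2 * r⁻¹) (Ioc 0 b) := by
    refine (hi.mono_set (Ioc_subset_Ioc_right hbT)).mono'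
      (by exact (measurable_inv.const_mul (c / 2)).aestronglyMeasurable) ?_
    refine (ae_restrict_iff' measurableSet_Ioc).2 (ae_of_all _ fun r hr => ?_)
    have hr0 : 0 < r := hr.1
    rw [Real.norm_of_nonneg (by positivity)]
    refine le_trans ?_ (eDens_mul_sq_ge hr0)
    have h1 : c < skyrme (u T r) ^ 2 := hball (by
      rw [Real.dist_eq, sub_zero, abs_of_pos hr0]
      exact hr.2.trans_lt hbd)
    calc c / 2 * r⁻¹ = c * r / (2 * r ^ 2) := by field_simp
      _ ≤ skyrme (u T r) ^ 2 / (2 * r ^ 2) := by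
        gcongr
        nlinarith [hr.2]
  have h2 : IntervalIntegrable (fun r : ℝ => r⁻¹) volume 0 b := by
    rw [intervalIntegrable_iff_integrableOn_Ioc_of_le hb.le]
    have h3 := Integrable.const_mul hint (c / 2)⁻¹
    refine h3.congr (ae_of_all _ fun r => ?_)
    field_simp
  rw [intervalIntegrable_inv_iff] at h2
  rcases h2 with h2 | h2
  · exact hb.ne h2
  · exact h2 left_mem_uIcc

lemma eq_zero_of_sin_eq_zero {f : ℝ → ℝ} {S : Set ℝ} (hS : IsPreconnected S)
    (hf : ContinuousOn f S) (hsin : ∀ x ∈ S, Real.sin (f x) = 0) {a : ℝ} (ha : a ∈ S)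
    (hfa : f a = 0) : ∀ x ∈ S, f x = 0 := by
  have hpos : ∀ g : ℝ → ℝ, ContinuousOn g S → (∀ x ∈ S, Real.sin (g x) = 0) → g a = 0 →
      ∀ x ∈ S, g x ≤ 0 := by
    intro g hg hs hga x hx
    by_contra! hlt
    have hmem : min (g x) 1 ∈ Icc (g a) (g x) :=
      ⟨by rw [hga]; exact le_min hlt.le zero_le_one, min_le_left _ _⟩
    obtain ⟨z, hz, hgz⟩ := hS.intermediate_value ha hx hg hmem
    have h0 : 0 < Real.sin (min (g x) 1) :=
      Real.sin_pos_of_pos_of_lt_pi (by positivity)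
        ((min_le_right _ _).trans_lt (by linarith [Real.pi_gt_three]))
    rw [← hgz, hs z hz] at h0
    exact lt_irrefl _ h0
  intro x hx
  have h1 := hpos f hf hsin hfa x hx
  have h2 := hpos (fun x => -f x) hf.neg (fun x hx => by simp [hsin x hx]) (by simp [hfa]) x hx
  linarith

lemma BackwardFramework.eq_zero_on_axis {u : ℝ → ℝ → ℝ} {T : ℝ} (h : BackwardFramework u T)
    {t : ℝ} (ht : t ∈ Ioo 0 (2 * T)) : u t 0 = 0 := by
  obtain ⟨hT, ⟨V, hV, hDV, hu⟩, heq, hE⟩ := h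
  have hD : ∀ t ∈ Ioo 0 (2 * T), (t, (0 : ℝ)) ∈ V := fun t ht =>
    hDV ⟨ht.1, ht.2.le, le_rfl, le_min (sub_nonneg.2 ht.2.le) ht.1.le⟩
  have hu : SmoothOn u V := hu
  have hTm : T ∈ Ioo 0 (2 * T) := ⟨hT, by linarith⟩
  refine eq_zero_of_sin_eq_zero (f := fun t => u t 0) isPreconnected_Ioo
    (fun s hs => (hu.continuousAt_fst hV (hD s hs)).continuousWithinAt) (fun s hs => ?_) hTm
    (eq_zero_of_finite_energy hT (hu.continuousAt_snd hV (hD T hTm)) hE) t ht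
  refine sin_eq_zero_on_axis hu hV (hD s hs) ?_
  have hm : 0 < min (2 * T - s) s := lt_min (sub_pos.2 hs.2) hs.1
  filter_upwards [Ioc_mem_nhdsGT hm] with r hr
  exact heq (s, r) ⟨hs.1, hs.2.le, hr.1.le, hr.2⟩ hr.1

/-- The Morawetz identity on a rectangle in the coordinates of `coneMap`: apart from the values on
the edges `x = b` and `y = δ`, all boundary terms have a sign. -/
lemma integral_morawetz_le {u : ℝ → ℝ → ℝ} {V : Set (ℝ × ℝ)} {ε b δ η M : ℝ}
    (hu : SmoothOn u V) (hV : IsOpen V) (hε : 0 < ε) (hεb : ε ≤ b) (hδ : 0 < δ) (hδ' : δ ≤ 1 / 2)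
    (hmem : ∀ x ∈ Icc ε b, ∀ y ∈ Icc δ (1 / 2), (x * (1 - y), x * y) ∈ V)
    (heq : ∀ x ∈ Icc ε b, ∀ y ∈ Icc δ (1 / 2), ANeq u (x * (1 - y)) (x * y))
    (hM0 : 0 ≤ M) (hη0 : 0 ≤ η)
    (hη : ∀ x ∈ Icc ε b, potential u (x, δ) ≤ η)
    (hM : ∀ y ∈ Icc δ (1 / 2), fieldFst u (b, y) ≤ M) :
    IntegrableOn (fun p : ℝ × ℝ => p.1 * morawetz u (p.1 * (1 - p.2)) (p.1 * p.2))
      (Icc (ε, δ) (b, 1 / 2)) ∧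
    ∫ p in Icc (ε, δ) (b, 1 / 2), p.1 * morawetz u (p.1 * (1 - p.2)) (p.1 * p.2) ≤
      b * η + M := by
  have hsplit : ∀ p ∈ Icc (ε, δ) (b, (1 / 2 : ℝ)), p.1 ∈ Icc ε b ∧ p.2 ∈ Icc δ (1 / 2) :=
    fun p hp => ⟨⟨hp.1.1, hp.2.1⟩, ⟨hp.1.2, hp.2.2⟩⟩
  have hA : ∀ x ∈ Icc ε b, ∀ y ∈ Icc δ (1 / 2), DifferentiableAt ℝ (fieldFst u) (x, y) :=
    fun x hx y hy => hu.differentiableAt_fieldFst hV (hmem x hx y hy)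
  have hB : ∀ x ∈ Icc ε b, ∀ y ∈ Icc δ (1 / 2), DifferentiableAt ℝ (fieldSnd u) (x, y) :=
    fun x hx y hy => hu.differentiableAt_fieldSnd hV (hmem x hx y hy)
      (hε.trans_le hx.1).ne' (hδ.trans_le hy.1).ne'
  have hdiv : EqOn (fun p : ℝ × ℝ => fderiv ℝ (fieldFst u) p (1, 0) + fderiv ℝ (fieldSnd u) p (0, 1))
      (fun p : ℝ × ℝ => p.1 * morawetz u (p.1 * (1 - p.2)) (p.1 * p.2))
      (Icc (ε, δ) (b, 1 / 2)) := by
    rintro ⟨x, y⟩ hp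
    obtain ⟨hx, hy⟩ := hsplit _ hp
    exact hu.divergence_eq hV (hmem x hx y hy) (hε.trans_le hx.1).ne' (hδ.trans_le hy.1).ne'
      (heq x hx y hy)
  have hint : IntegrableOn (fun p : ℝ × ℝ => p.1 * morawetz u (p.1 * (1 - p.2)) (p.1 * p.2))
      (Icc (ε, δ) (b, 1 / 2)) := by
    refine ContinuousOn.integrableOn_compact isCompact_Icc ?_
    rintro ⟨x, y⟩ hp
    obtain ⟨hx, hy⟩ := hsplit _ hp
    have hw := (hu.differentiableAt_coneMap hV (hmem x hx y hy)).continuousAt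
    have hF := continuous_skyrme.continuousAt.comp hw
    have hr : (fun p : ℝ × ℝ => p.1 * p.2) (x, y) ≠ 0 :=
      (mul_pos (hε.trans_le hx.1) (hδ.trans_le hy.1)).ne'
    have hr3 : (fun p : ℝ × ℝ => (p.1 * p.2) ^ 3) (x, y) ≠ 0 := pow_ne_zero 3 hr
    have hcr : ContinuousAt (fun p : ℝ × ℝ => p.1 * p.2) (x, y) := by fun_prop
    have hcr3 : ContinuousAt (fun p : ℝ × ℝ => (p.1 * p.2) ^ 3) (x, y) := by fun_prop
    have hs := Real.continuous_sin.continuousAt.comp (hw.const_mul 2)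
    have hc := Real.continuous_cos.continuousAt.comp (hw.const_mul 2)
    exact (continuousAt_fst.mul ((((hF.pow 2).div hcr3 hr3).add ((hw.mul hs).div hcr hr)).add
      (((hw.mul hF).mul (continuousAt_const.sub hc)).div hcr3 hr3))).continuousWithinAt
  have hle : ((ε, δ) : ℝ × ℝ) ≤ (b, 1 / 2) := ⟨hεb, hδ'⟩
  have key := integral_divergence_prod_Icc_of_hasFDerivAt_of_le (fieldFst u) (fieldSnd u)
    (fderiv ℝ (fieldFst u)) (fderiv ℝ (fieldSnd u)) (ε, δ) (b, 1 / 2) hle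
    (fun p hp => (hA _ (hsplit p hp).1 _ (hsplit p hp).2).continuousAt.continuousWithinAt)
    (fun p hp => (hB _ (hsplit p hp).1 _ (hsplit p hp).2).continuousAt.continuousWithinAt)
    (fun p hp => (hA _ (Ioo_subset_Icc_self hp.1) _ (Ioo_subset_Icc_self hp.2)).hasFDerivAt)
    (fun p hp => (hB _ (Ioo_subset_Icc_self hp.1) _ (Ioo_subset_Icc_self hp.2)).hasFDerivAt)
    (hint.congr_fun hdiv.symm measurableSet_Icc)
  rw [setIntegral_congr_fun measurableSet_Icc hdiv] at key
  refine ⟨hint, key.le.trans ?_⟩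
  have hpot : ∀ p : ℝ × ℝ, 0 ≤ potential u p := fun p => by unfold potential; positivity
  have i1 : ∫ x in ε..b, fieldSnd u (x, 1 / 2) ≤ 0 := by
    rw [intervalIntegral.integral_of_le hεb]
    refine integral_nonpos fun x => ?_
    have := hpot (x, 1 / 2)
    simp only [fieldSnd, Pi.zero_apply]
    linarith
  have hBc : ContinuousOn (fun x => fieldSnd u (x, δ)) (uIcc ε b) := by
    rw [uIcc_of_le hεb]
    intro x hx
    exact (ContinuousAt.comp (f := fun x : ℝ => (x, δ)) (g := fieldSnd u)
      (hB x hx δ ⟨le_rfl, hδ'⟩).continuousAt (by fun_prop)).continuousWithinAt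
  have hAc : ContinuousOn (fun y => fieldFst u (b, y)) (uIcc δ (1 / 2)) := by
    rw [uIcc_of_le hδ']
    intro y hy
    exact (ContinuousAt.comp (f := fun y : ℝ => (b, y)) (g := fieldFst u)
      (hA b ⟨hεb, le_rfl⟩ y hy).continuousAt (by fun_prop)).continuousWithinAt
  have i2 : (b - ε) * (-η) ≤ ∫ x in ε..b, fieldSnd u (x, δ) := by
    rw [← smul_eq_mul, ← intervalIntegral.integral_const]
    refine intervalIntegral.integral_mono_on hεb (by simp) hBc.intervalIntegrable fun x hx => ?_
    have h1 := hη x hx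
    have h2 : 0 ≤ (1 - 2 * δ) / 2 * nullDeriv u (x, δ) ^ 2 :=
      mul_nonneg (by linarith) (sq_nonneg _)
    simp only [fieldSnd]
    linarith
  have i3 : ∫ y in δ..(1 / 2), fieldFst u (b, y) ≤ (1 / 2 - δ) * M := by
    rw [← smul_eq_mul, ← intervalIntegral.integral_const]
    exact intervalIntegral.integral_mono_on hδ' hAc.intervalIntegrable (by simp) hM
  have i4 : 0 ≤ ∫ y in δ..(1 / 2), fieldFst u (ε, y) :=
    intervalIntegral.integral_nonneg hδ' fun y _ => mul_nonneg hε.le (sq_nonneg _)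
  simp only
  nlinarith [mul_nonneg hε.le hη0, mul_nonneg hδ.le hM0]

/-- Near the axis the potential is small, locally uniformly away from the origin. -/
lemma exists_potential_le {u : ℝ → ℝ → ℝ} {V : Set (ℝ × ℝ)} {ε b : ℝ}
    (hu : SmoothOn u V) (hV : IsOpen V) (hε : 0 < ε)
    (hmem : ∀ x ∈ Icc ε b, ∀ y ∈ Icc (0 : ℝ) (1 / 2), (x * (1 - y), x * y) ∈ V)
    (h0 : ∀ x ∈ Icc ε b, u x 0 = 0) :
    ∃ K, 0 ≤ K ∧ ∀ x ∈ Icc ε b, ∀ y ∈ Ioc (0 : ℝ) (1 / 2), potential u (x, y) ≤ K * y := by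
  have hcont : ContinuousOn (fun p : ℝ × ℝ => p.1 * (ur u (p.1 * (1 - p.2)) (p.1 * p.2) -
      ut u (p.1 * (1 - p.2)) (p.1 * p.2))) (Icc ε b ×ˢ Icc (0 : ℝ) (1 / 2)) := by
    rintro ⟨x, y⟩ ⟨hx, hy⟩
    have h1 := ((hu.ur hV).differentiableAt_coneMap hV (hmem x hx y hy)).continuousAt
    have h2 := ((hu.ut hV).differentiableAt_coneMap hV (hmem x hx y hy)).continuousAt
    exact (continuousAt_fst.mul (h1.sub h2)).continuousWithinAt
  obtain ⟨C, hC⟩ := (isCompact_Icc.prod isCompact_Icc).exists_bound_of_continuousOn hcont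
  refine ⟨C ^ 2 + 2 * C ^ 6 / ε ^ 2, by positivity, fun x hx y hy => ?_⟩
  have hx0 : 0 < x := hε.trans_le hx.1
  have hy0 : 0 < y := hy.1
  have hlip := norm_image_sub_le_of_norm_deriv_le_segment'
    (f := fun y => u (x * (1 - y)) (x * y)) (a := 0) (b := 1 / 2) (C := C)
    (fun z hz => (hu.hasDerivAt_snd hV (hmem x hx z hz)).hasDerivWithinAt)
    (fun z hz => hC (x, z) ⟨hx, Ico_subset_Icc_self hz⟩) y ⟨hy.1.le, hy.2⟩
  simp only [sub_zero, mul_one, mul_zero, h0 x hx, Real.norm_eq_abs] at hlip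
  set w := u (x * (1 - y)) (x * y) with hw
  have hw2 : w ^ 2 ≤ (C * y) ^ 2 := by
    rw [← sq_abs]
    gcongr
  have hF : skyrme w ^ 2 ≤ 4 * (C * y) ^ 6 := by
    calc skyrme w ^ 2 = |skyrme w| ^ 2 := (sq_abs _).symm
      _ ≤ (2 * |w| ^ 3) ^ 2 := by gcongr; exact abs_skyrme_le w
      _ = 4 * |w| ^ 6 := by ring
      _ ≤ 4 * (C * y) ^ 6 := by gcongr
  have hsin : Real.sin w ^ 2 ≤ w ^ 2 := Real.sin_sq_le_sq
  have hy1 : y ^ 2 ≤ y := by nlinarith [hy.2]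
  have hy4 : y ^ 4 ≤ y := by nlinarith [hy.2, sq_nonneg y]
  calc potential u (x, y) = Real.sin w ^ 2 + skyrme w ^ 2 / (2 * (x * y) ^ 2) := rfl
    _ ≤ (C * y) ^ 2 + 4 * (C * y) ^ 6 / (2 * (ε * y) ^ 2) := by
      refine add_le_add (hsin.trans hw2) ?_
      gcongr
      exact hx.1
    _ = C ^ 2 * y ^ 2 + 2 * C ^ 6 / ε ^ 2 * y ^ 4 := by
      field_simp
      ring
    _ ≤ C ^ 2 * y + 2 * C ^ 6 / ε ^ 2 * y := by gcongr
    _ = (C ^ 2 + 2 * C ^ 6 / ε ^ 2) * y := by ring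

lemma image_coneMap (T : ℝ) :
    coneMap '' (Ioc 0 (2 * T) ×ˢ Ioc 0 (1 / 2)) = Dcone T := by
  ext ⟨t, r⟩
  constructor
  · rintro ⟨⟨x, y⟩, ⟨⟨hx0, hxT⟩, ⟨hy0, hy⟩⟩, h⟩
    simp only at hx0 hxT hy0 hy
    obtain ⟨rfl, rfl⟩ := Prod.mk.inj h
    refine ⟨mul_pos hx0 hy0, le_min ?_ ?_⟩ <;> simp only <;> nlinarith
  · rintro ⟨hr, hle⟩
    obtain ⟨h1, h2⟩ := le_min_iff.1 hle
    simp only at hr h1 h2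
    have hx : 0 < t + r := by linarith
    refine ⟨(t + r, r / (t + r)), ⟨⟨hx, by linarith⟩, ⟨by positivity, ?_⟩⟩, ?_⟩
    · rw [div_le_iff₀ hx]
      linarith
    · simp only [coneMap, Prod.mk.injEq]
      constructor <;> field_simp
      ring

lemma injOn_coneMap (T : ℝ) : InjOn coneMap (Ioc 0 (2 * T) ×ˢ Ioc 0 (1 / 2)) := by
  rintro ⟨x, y⟩ ⟨⟨hx, -⟩, -⟩ ⟨x', y'⟩ - h
  obtain ⟨h1, h2⟩ := Prod.mk.inj h
  simp only at hx h1 h2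
  have hxx : x = x' := by linarith
  subst hxx
  rw [mul_left_cancel₀ (ne_of_gt hx) h2]

/-- The derivative of `coneMap`. -/
noncomputable def fderivConeMap (p : ℝ × ℝ) : ℝ × ℝ →L[ℝ] ℝ × ℝ :=
  (Matrix.toLin (.finTwoProd ℝ) (.finTwoProd ℝ)
    !![1 - p.2, -p.1; p.2, p.1]).toContinuousLinearMap

lemma hasFDerivAt_coneMap (p : ℝ × ℝ) : HasFDerivAt coneMap (fderivConeMap p) p := by
  unfold fderivConeMap
  rw [Matrix.toLin_finTwoProd_toContinuousLinearMap]
  have h1 : HasFDerivAt (fun p : ℝ × ℝ => p.1) (ContinuousLinearMap.fst ℝ ℝ ℝ) p := hasFDerivAt_fst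
  have h2 : HasFDerivAt (fun p : ℝ × ℝ => p.2) (ContinuousLinearMap.snd ℝ ℝ ℝ) p := hasFDerivAt_snd
  convert! (h1.mul (h2.const_sub 1)).prodMk (h1.mul h2) using 1
  ext <;> simp

lemma det_fderivConeMap (p : ℝ × ℝ) : (fderivConeMap p).det = p.1 := by
  unfold fderivConeMap
  simp only [LinearMap.det_toContinuousLinearMap, LinearMap.det_toLin, Matrix.det_fin_two_of]
  ring

lemma lintegral_Dcone (T : ℝ) (f : ℝ × ℝ → ℝ) :
    ∫⁻ p in Dcone T, ENNReal.ofReal (f p) =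
      ∫⁻ p in Ioc 0 (2 * T) ×ˢ Ioc 0 (1 / 2), ENNReal.ofReal (p.1 * f (coneMap p)) := by
  have hm : MeasurableSet (Ioc 0 (2 * T) ×ˢ Ioc (0 : ℝ) (1 / 2)) :=
    measurableSet_Ioc.prod measurableSet_Ioc
  rw [← image_coneMap, lintegral_image_eq_lintegral_abs_det_fderiv_mul volume hm
    (fun p _ => (hasFDerivAt_coneMap p).hasFDerivWithinAt) (injOn_coneMap T)]
  refine setLIntegral_congr_fun hm fun p hp => ?_
  have hp0 : 0 < p.1 := hp.1.1
  simp only [det_fderivConeMap]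
  rw [abs_of_pos hp0, ENNReal.ofReal_mul hp0.le]

lemma setLIntegral_Ioc_prod_le {b c : ℝ} (hb : 0 < b) (hc : 0 < c) {g : ℝ × ℝ → ENNReal}
    {C : ENNReal}
    (h : ∀ ε ∈ Ioc 0 b, ∀ δ ∈ Ioc 0 c, ∫⁻ p in Icc (ε, δ) (b, c), g p ≤ C) :
    ∫⁻ p in Ioc 0 b ×ˢ Ioc 0 c, g p ≤ C := by
  have hmono : Monotone fun n : ℕ => Icc (b / (n + 1), c / (n + 1)) (b, c) := by
    intro m n hmn
    refine Icc_subset_Icc_left ⟨?_, ?_⟩ <;> simp only <;> gcongr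
  have hU : Ioc 0 b ×ˢ Ioc 0 c ⊆ ⋃ n : ℕ, Icc (b / (n + 1), c / (n + 1)) (b, c) := by
    rintro ⟨x, y⟩ ⟨⟨hx0, hx⟩, ⟨hy0, hy⟩⟩
    simp only at hx0 hx hy0 hy
    obtain ⟨n, hn⟩ := exists_nat_ge (max (b / x) (c / y))
    have h1 : b / x ≤ n := (le_max_left _ _).trans hn
    have h2 : c / y ≤ n := (le_max_right _ _).trans hn
    rw [div_le_iff₀ hx0] at h1
    rw [div_le_iff₀ hy0] at h2
    refine mem_iUnion.2 ⟨n, ⟨?_, ?_⟩, hx, hy⟩ <;> simp only <;> rw [div_le_iff₀ (by positivity)] <;>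
      linarith
  refine (lintegral_mono_set hU).trans ?_
  rw [setLIntegral_iUnion_of_directed _ hmono.directed_le]
  refine iSup_le fun n => h _ ⟨by positivity, ?_⟩ _ ⟨by positivity, ?_⟩
  · exact div_le_self hb.le (by simp)
  · exact div_le_self hc.le (by simp)

lemma BackwardFramework.lintegral_rect_le {u : ℝ → ℝ → ℝ} {Tbar T : ℝ}
    (h : BackwardFramework u Tbar) (hT : 0 < T) (hT1 : T ≤ 1) (hTlt : T < Tbar) :
    ∃ C : ENNReal, C < ⊤ ∧ ∀ ε ∈ Ioc 0 (2 * T), ∀ δ ∈ Ioc (0 : ℝ) (1 / 2),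
      ∫⁻ p in Icc (ε, δ) (2 * T, 1 / 2), ENNReal.ofReal
        (p.1 * morawetz u (p.1 * (1 - p.2)) (p.1 * p.2)) ≤ C := by
  have haxis : ∀ t ∈ Ioo 0 (2 * Tbar), u t 0 = 0 := fun t ht => h.eq_zero_on_axis ht
  obtain ⟨-, ⟨V, hV, hDV, hu⟩, heq, -⟩ := h
  have hu : SmoothOn u V := hu
  have hD : ∀ x ∈ Ioc 0 (2 * T), ∀ y ∈ Icc (0 : ℝ) (1 / 2),
      (x * (1 - y), x * y) ∈ Dom Tbar := by
    rintro x ⟨hx0, hx⟩ y ⟨hy0, hy⟩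
    refine ⟨mul_pos hx0 (by linarith), ?_, mul_nonneg hx0.le hy0, le_min ?_ ?_⟩ <;>
      simp only <;> nlinarith
  have hb : 2 * T ∈ Ioc 0 (2 * T) := ⟨by positivity, le_rfl⟩
  have hcont : ContinuousOn (fun y => fieldFst u (2 * T, y)) (Icc 0 (1 / 2)) := fun y hy =>
    (ContinuousAt.comp (f := fun y : ℝ => (2 * T, y)) (g := fieldFst u)
      (hu.differentiableAt_fieldFst hV (hDV (hD _ hb y hy))).continuousAt
      (by fun_prop)).continuousWithinAt
  obtain ⟨M, hM⟩ := isCompact_Icc.exists_bound_of_continuousOn hcont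
  have hM0 : 0 ≤ M := (norm_nonneg _).trans (hM 0 ⟨le_rfl, by norm_num⟩)
  refine ⟨ENNReal.ofReal (1 + M), ENNReal.ofReal_lt_top, fun ε hε δ hδ => ?_⟩
  have hx' : ∀ x ∈ Icc ε (2 * T), x ∈ Ioc 0 (2 * T) := fun x hx => ⟨hε.1.trans_le hx.1, hx.2⟩
  obtain ⟨K, hK0, hK⟩ := exists_potential_le hu hV hε.1
    (fun x hx y hy => hDV (hD x (hx' x hx) y hy))
    (fun x hx => haxis x ⟨(hx' x hx).1, by linarith [hx.2]⟩)
  set d := min δ (1 / (2 * T * K + 1)) with hd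
  have hden : 0 < 2 * T * K + 1 := by positivity
  have hd0 : 0 < d := lt_min hδ.1 (by positivity)
  have hdδ : d ≤ δ := min_le_left _ _
  have hd1 : 2 * T * (K * d) ≤ 1 := by
    have h1 : d * (2 * T * K + 1) ≤ 1 := (le_div_iff₀ hden).1 (min_le_right _ _)
    linarith
  have hy' : ∀ y ∈ Icc d (1 / 2), y ∈ Icc (0 : ℝ) (1 / 2) := fun y hy => ⟨hd0.le.trans hy.1, hy.2⟩
  obtain ⟨hint, hle⟩ := integral_morawetz_le (η := K * d) (M := M) hu hV hε.1 hε.2 hd0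
    (hdδ.trans hδ.2) (fun x hx y hy => hDV (hD x (hx' x hx) y (hy' y hy)))
    (fun x hx y hy => heq _ (hD x (hx' x hx) y (hy' y hy))
      (mul_pos (hx' x hx).1 (hd0.trans_le hy.1)))
    hM0 (by positivity) (fun x hx => hK x hx d ⟨hd0, hdδ.trans hδ.2⟩)
    (fun y hy => (le_abs_self _).trans (hM y (hy' y hy)))
  have hnn : 0 ≤ᵐ[volume.restrict (Icc (ε, d) (2 * T, 1 / 2))]
      fun p : ℝ × ℝ => p.1 * morawetz u (p.1 * (1 - p.2)) (p.1 * p.2) := by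
    refine (ae_restrict_iff' measurableSet_Icc).2 (ae_of_all _ fun p hp => ?_)
    have hx0 : 0 < p.1 := hε.1.trans_le hp.1.1
    have hy0 : 0 < p.2 := hd0.trans_le hp.1.2
    have hx1 : p.1 ≤ 2 * T := hp.2.1
    have hy1 : p.2 ≤ 1 / 2 := hp.2.2
    exact mul_nonneg hx0.le (morawetz_nonneg (mul_pos hx0 hy0) (by nlinarith))
  calc ∫⁻ p in Icc (ε, δ) (2 * T, 1 / 2), ENNReal.ofReal
        (p.1 * morawetz u (p.1 * (1 - p.2)) (p.1 * p.2))
      ≤ ∫⁻ p in Icc (ε, d) (2 * T, 1 / 2), ENNReal.ofReal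
        (p.1 * morawetz u (p.1 * (1 - p.2)) (p.1 * p.2)) :=
        lintegral_mono_set (Icc_subset_Icc_left ⟨le_rfl, hdδ⟩)
    _ = ENNReal.ofReal (∫ p in Icc (ε, d) (2 * T, 1 / 2),
        p.1 * morawetz u (p.1 * (1 - p.2)) (p.1 * p.2)) :=
        (ofReal_integral_eq_lintegral_ofReal hint hnn).symm
    _ ≤ ENNReal.ofReal (1 + M) := ENNReal.ofReal_le_ofReal (by linarith)

/-- Finiteness of the nonnegative spacetime integral on `D(0,T)` for some small `T`:
`∫∫_{D(0,T)} [(u - sin u cos u)²/r⁵ + u sin 2u/r³ + u (u - sin u cos u)(1 - cos 2u)/r⁵] r² < ∞`. -/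
theorem spacetime_integral_finite (u : ℝ → ℝ → ℝ) (Tbar : ℝ)
    (h : BackwardFramework u Tbar) :
    ∃ T : ℝ, 0 < T ∧ T ≤ Tbar ∧
      (∫⁻ p in Dcone T, ENNReal.ofReal
        (((u p.1 p.2 - Real.sin (u p.1 p.2) * Real.cos (u p.1 p.2)) ^ 2 / p.2 ^ 5 +
          u p.1 p.2 * Real.sin (2 * u p.1 p.2) / p.2 ^ 3 +
          u p.1 p.2 * (u p.1 p.2 - Real.sin (u p.1 p.2) * Real.cos (u p.1 p.2)) *
            (1 - Real.cos (2 * u p.1 p.2)) / p.2 ^ 5) * p.2 ^ 2)) < ⊤ := by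
  have hTbar : 0 < Tbar := h.1
  have hT : 0 < min (Tbar / 2) 1 := by positivity
  have hTlt : min (Tbar / 2) 1 < Tbar := (min_le_left _ _).trans_lt (half_lt_self hTbar)
  obtain ⟨C, hC, hle⟩ := h.lintegral_rect_le hT (min_le_right _ _) hTlt
  refine ⟨min (Tbar / 2) 1, hT, hTlt.le, ?_⟩
  rw [lintegral_Dcone]
  refine lt_of_eq_of_lt (setLIntegral_congr_fun (measurableSet_Ioc.prod measurableSet_Ioc)
    fun p hp => ?_) ((setLIntegral_Ioc_prod_le (by positivity) (by norm_num) hle).trans_lt hC)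
  have hr : p.1 * p.2 ≠ 0 := (mul_pos hp.1.1 hp.2.1).ne'
  simp only [coneMap, morawetz, skyrme]
  congr 2
  field_simp
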